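/- Let M(λ) ∈ F[λ]^{m×(m+n)} be a polynomial matrix, let d_1, …, d_m be its row degrees, let M_hr be its highest-row-degree coefficient matrix, let S_k be its Sylvester matrices with ranks r_k. Then M(λ) is a minimal basis if and only if rank(M_hr) = m and there exists an index k with r_{k+1} = r_k + m such that, denoting by d' the smallest such index, r_{d'} − m·d' = d_1 + d_2 + ⋯ + d_m. -/

import Mathlib

open Polynomial Matrix

noncomputable section

variable {F : Type*} [Field F]

/-- The rows of a polynomial matrix, viewed as vectors of rational functions. -/
def ratRow {p q : ℕ} (M : Matrix (Fin p) (Fin q) F[X]) (i : Fin p) :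
    Fin q → RatFunc F :=
  fun j => algebraMap F[X] (RatFunc F) (M i j)

/-- The rational vector subspace spanned by the rows of a polynomial matrix. -/
def rowSpan {p q : ℕ} (M : Matrix (Fin p) (Fin q) F[X]) :
    Submodule (RatFunc F) (Fin q → RatFunc F) :=
  Submodule.span (RatFunc F) (Set.range (ratRow M))

/-- The degree of the `i`-th row of a polynomial matrix. -/
def rowDeg {p q : ℕ} (M : Matrix (Fin p) (Fin q) F[X]) (i : Fin p) : ℕ :=
  Finset.univ.sup fun j => (M i j).natDegree

/-- The rows of `M` form a polynomial basis of the rational subspace `V` whose sum of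
row degrees is minimal among all polynomial bases of `V`. -/
def IsMinimalBasisOf {p q : ℕ} (V : Submodule (RatFunc F) (Fin q → RatFunc F))
    (M : Matrix (Fin p) (Fin q) F[X]) : Prop :=
  LinearIndependent (RatFunc F) (ratRow M) ∧ rowSpan M = V ∧
    ∀ M' : Matrix (Fin p) (Fin q) F[X],
      LinearIndependent (RatFunc F) (ratRow M') → rowSpan M' = V →
        ∑ i, rowDeg M i ≤ ∑ i, rowDeg M' i

/-- A polynomial matrix is a minimal basis if its rows form a minimal basis of the
rational subspace they span. -/
def IsMinimalBasis {p q : ℕ} (M : Matrix (Fin p) (Fin q) F[X]) : Prop :=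
  IsMinimalBasisOf (rowSpan M) M

/-- A polynomial matrix viewed as a matrix of rational functions. -/
def ratMat {p q : ℕ} (M : Matrix (Fin p) (Fin q) F[X]) :
    Matrix (Fin p) (Fin q) (RatFunc F) :=
  M.map (algebraMap F[X] (RatFunc F))

/-- The right null-space over `F(λ)` of a polynomial matrix. -/
def rightNullSpace {p q : ℕ} (M : Matrix (Fin p) (Fin q) F[X]) :
    Submodule (RatFunc F) (Fin q → RatFunc F) :=
  LinearMap.ker (Matrix.mulVecLin (ratMat M))

/-- The `k`-th Sylvester matrix of a polynomial matrix regarded as having degree at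
most `e`: the block-Toeplitz matrix with `k` block columns whose `j`-th block column
carries the coefficients `M_0, …, M_e` in block rows `j, …, j+e` and zeros elsewhere. -/
def sylv {p q : ℕ} (e k : ℕ) (M : Matrix (Fin p) (Fin q) F[X]) :
    Matrix (Fin (k + e) × Fin p) (Fin k × Fin q) F :=
  fun r c =>
    if (c.1 : ℕ) ≤ (r.1 : ℕ) ∧ (r.1 : ℕ) ≤ (c.1 : ℕ) + e then
      (M r.2 c.2).coeff ((r.1 : ℕ) - (c.1 : ℕ))
    else 0

/-- `M`, regarded as a polynomial matrix of degree at most `e`, has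
full-Sylvester-rank if every Sylvester matrix `S_k`, `k ≥ 1`, has full rank. -/
def HasFullSylvesterRank {p q : ℕ} (e : ℕ) (M : Matrix (Fin p) (Fin q) F[X]) : Prop :=
  ∀ k : ℕ, 1 ≤ k → (sylv e k M).rank = min ((k + e) * p) (k * q)

/-- The `k`-th coefficient matrix of a polynomial matrix. -/
def coeffMat {p q : ℕ} (k : ℕ) (M : Matrix (Fin p) (Fin q) F[X]) :
    Matrix (Fin p) (Fin q) F :=
  fun i j => (M i j).coeff k

/-- The highest-row-degree coefficient matrix: its `i`-th row is the coefficient of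
`λ^{d_i}` in the `i`-th row of `M`, where `d_i` is the `i`-th row degree. -/
def highRowMat {p q : ℕ} (M : Matrix (Fin p) (Fin q) F[X]) :
    Matrix (Fin p) (Fin q) F :=
  fun i j => (M i j).coeff (rowDeg M i)

/-- The `e`-reversal of a polynomial matrix: `rev_e P(λ) = λ^e P(1/λ)`. -/
def revMat {p q : ℕ} (e : ℕ) (P : Matrix (Fin p) (Fin q) F[X]) :
    Matrix (Fin p) (Fin q) F[X] :=
  fun i j => (P i j).reflect e



/-- Multiplication by a polynomial matrix, as an `F`-linear map between spaces of polynomial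
vectors. -/
def polyMulVec {p q : ℕ} (M : Matrix (Fin p) (Fin q) F[X]) :
    (Fin q → F[X]) →ₗ[F] (Fin p → F[X]) :=
  M.mulVecLin.restrictScalars F

@[simp]
lemma polyMulVec_apply {p q : ℕ} (M : Matrix (Fin p) (Fin q) F[X]) (v : Fin q → F[X]) :
    polyMulVec M v = M *ᵥ v := rfl

/-- The polynomial vectors whose `i`-th entry has degree less than `a i`. -/
def vecDegreeLT (F : Type*) [Field F] {p : ℕ} (a : Fin p → ℕ) : Submodule F (Fin p → F[X]) :=
  Submodule.pi Set.univ fun i => degreeLT F (a i)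

lemma mem_vecDegreeLT {p : ℕ} {a : Fin p → ℕ} {v : Fin p → F[X]} :
    v ∈ vecDegreeLT F a ↔ ∀ i t, a i ≤ t → (v i).coeff t = 0 := by
  simp [vecDegreeLT, Submodule.mem_pi, mem_degreeLT, degree_lt_iff_coeff_zero]

/-- The space of polynomial vectors with bounded entry degrees is the product of the spaces of
polynomials with these bounds. -/
def vecDegreeLTEquiv (F : Type*) [Field F] {p : ℕ} (a : Fin p → ℕ) :
    vecDegreeLT F a ≃ₗ[F] (∀ i, degreeLT F (a i)) where
  toFun x i := ⟨x.1 i, x.2 i trivial⟩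
  invFun y := ⟨fun i => y i, fun i _ => (y i).2⟩
  map_add' _ _ := rfl
  map_smul' _ _ := rfl
  left_inv _ := rfl
  right_inv _ := rfl

instance degreeLT_finite (k : ℕ) : Module.Finite F (degreeLT F k) :=
  Module.Finite.equiv (degreeLTEquiv F k).symm

instance vecDegreeLT_finite {p : ℕ} (a : Fin p → ℕ) : Module.Finite F (vecDegreeLT F a) :=
  Module.Finite.equiv (vecDegreeLTEquiv F a).symm

lemma finrank_vecDegreeLT {p : ℕ} (a : Fin p → ℕ) :
    Module.finrank F (vecDegreeLT F a) = ∑ i, a i := by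
  rw [(vecDegreeLTEquiv F a).finrank_eq, Module.finrank_pi_fintype]
  simp [(degreeLTEquiv F _).finrank_eq]

/-- The polynomial vector with prescribed coefficients of degree less than `k`. -/
def ofCoeffs (F : Type*) [Field F] (k q : ℕ) : (Fin k × Fin q → F) →ₗ[F] (Fin q → F[X]) where
  toFun x j := ∑ t : Fin k, monomial (t : ℕ) (x (t, j))
  map_add' x y := by ext1 j; simp [Finset.sum_add_distrib]
  map_smul' c x := by ext1 j; simp [Finset.smul_sum, smul_monomial]

lemma ofCoeffs_apply_coeff {k q : ℕ} (x : Fin k × Fin q → F) (j : Fin q) (t : ℕ) :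
    (ofCoeffs F k q x j).coeff t = if h : t < k then x (⟨t, h⟩, j) else 0 := by
  simp only [ofCoeffs, LinearMap.coe_mk, AddHom.coe_mk, finsetSum_coeff, coeff_monomial]
  split_ifs with h
  · rw [Finset.sum_eq_single ⟨t, h⟩] <;> simp +contextual [Fin.ext_iff]
  · exact Finset.sum_eq_zero fun s _ => if_neg (by omega)

lemma ofCoeffs_injective (k q : ℕ) : Function.Injective (ofCoeffs F k q) := by
  intro x y h
  ext ⟨t, j⟩
  have := congrArg (fun v => (v j).coeff t) h
  simpa [ofCoeffs_apply_coeff] using this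

lemma range_ofCoeffs (k q : ℕ) :
    LinearMap.range (ofCoeffs F k q) = vecDegreeLT F fun _ => k := by
  ext v
  rw [mem_vecDegreeLT]
  constructor
  · rintro ⟨x, rfl⟩ j t ht
    rw [ofCoeffs_apply_coeff, dif_neg (by omega)]
  · intro h
    refine ⟨fun c => (v c.2).coeff c.1, ?_⟩
    ext j t
    rw [ofCoeffs_apply_coeff]
    split_ifs with ht
    · rfl
    · exact (h j t (by omega)).symm

lemma ofCoeffs_sylv_mulVec {p q d : ℕ} (k : ℕ) (M : Matrix (Fin p) (Fin q) F[X])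
    (hdeg : ∀ i j, (M i j).natDegree ≤ d) (x : Fin k × Fin q → F) :
    ofCoeffs F (k + d) p (sylv d k M *ᵥ x) = M *ᵥ ofCoeffs F k q x := by
  ext i r
  have hR : (((M *ᵥ ofCoeffs F k q x) i).coeff r) = ∑ j, ∑ t : Fin k,
      if (t : ℕ) ≤ r then (M i j).coeff (r - t) * x (t, j) else 0 := by
    simp only [mulVec, dotProduct, ofCoeffs, LinearMap.coe_mk, AddHom.coe_mk, finsetSum_coeff,
      Finset.mul_sum, ← C_mul_X_pow_eq_monomial, ← mul_assoc, coeff_mul_X_pow', coeff_mul_C]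
  rw [hR, ofCoeffs_apply_coeff, Finset.sum_comm, ← Fintype.sum_prod_type']
  split_ifs with h
  · refine Finset.sum_congr rfl fun c _ => ?_
    simp only [sylv]
    by_cases h1 : (c.1 : ℕ) ≤ r
    · by_cases h2 : r ≤ (c.1 : ℕ) + d
      · simp [h1, h2]
      · rw [coeff_eq_zero_of_natDegree_lt ((hdeg i c.2).trans_lt (by omega))]
        simp [h2]
    · simp [h1]
  · refine (Finset.sum_eq_zero fun c _ => ?_).symm
    have := c.1.2
    rw [coeff_eq_zero_of_natDegree_lt ((hdeg i c.2).trans_lt (by omega))]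
    simp

/-- The rank of the `k`-th Sylvester matrix, as the dimension of the space of the products
`M v` with `v` a polynomial vector of degree less than `k`. -/
def sylvRank {p q : ℕ} (M : Matrix (Fin p) (Fin q) F[X]) (k : ℕ) : ℕ :=
  Module.finrank F ((vecDegreeLT F fun _ => k).map (polyMulVec M))

lemma rank_sylv {p q d : ℕ} (k : ℕ) (M : Matrix (Fin p) (Fin q) F[X])
    (hdeg : ∀ i j, (M i j).natDegree ≤ d) : (sylv d k M).rank = sylvRank M k := by
  have h : ofCoeffs F (k + d) p ∘ₗ (sylv d k M).mulVecLin = polyMulVec M ∘ₗ ofCoeffs F k q :=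
    LinearMap.ext fun x => ofCoeffs_sylv_mulVec k M hdeg x
  rw [sylvRank, ← range_ofCoeffs, ← LinearMap.range_comp, ← h, LinearMap.range_comp, Matrix.rank]
  exact (Submodule.equivMapOfInjective _ (ofCoeffs_injective _ _) _).finrank_eq

lemma sylvRank_add_finrank_ker {p q : ℕ} (M : Matrix (Fin p) (Fin q) F[X]) (k : ℕ) :
    sylvRank M k + Module.finrank F
      ((vecDegreeLT F fun _ => k) ⊓ LinearMap.ker (polyMulVec M) : Submodule F _) = q * k := by
  have h := ((polyMulVec M).domRestrict (vecDegreeLT F fun _ => k)).finrank_range_add_finrank_ker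
  rw [LinearMap.range_domRestrict, LinearMap.ker_domRestrict, finrank_vecDegreeLT] at h
  rw [sylvRank, ← Submodule.map_comap_subtype, ← (Submodule.equivMapOfInjective _
    (Submodule.subtype_injective _) _).finrank_eq]
  simpa using h

lemma natDegree_le_rowDeg {p q : ℕ} (M : Matrix (Fin p) (Fin q) F[X]) (i : Fin p) (j : Fin q) :
    (M i j).natDegree ≤ rowDeg M i :=
  Finset.le_sup (f := fun j => (M i j).natDegree) (Finset.mem_univ j)

lemma map_vecDegreeLT_le {p q : ℕ} (M : Matrix (Fin p) (Fin q) F[X]) (k : ℕ) :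
    (vecDegreeLT F fun _ => k).map (polyMulVec M) ≤ vecDegreeLT F fun i => k + rowDeg M i := by
  rintro _ ⟨v, hv, rfl⟩
  rw [SetLike.mem_coe, mem_vecDegreeLT] at hv
  rw [mem_vecDegreeLT]
  intro i t ht
  simp only [polyMulVec_apply, mulVec, dotProduct, finsetSum_coeff, coeff_mul]
  refine Finset.sum_eq_zero fun j _ => Finset.sum_eq_zero fun s hs => ?_
  rw [Finset.HasAntidiagonal.mem_antidiagonal] at hs
  by_cases h : k ≤ s.2
  · rw [hv j _ h, mul_zero]
  · have := natDegree_le_rowDeg M i j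
    rw [coeff_eq_zero_of_natDegree_lt (by omega), zero_mul]

lemma sylvRank_le {p q : ℕ} (M : Matrix (Fin p) (Fin q) F[X]) (k : ℕ) :
    sylvRank M k ≤ p * k + ∑ i, rowDeg M i := by
  refine (Submodule.finrank_mono (map_vecDegreeLT_le M k)).trans_eq ?_
  simp [finrank_vecDegreeLT, Finset.sum_add_distrib]

lemma sylvRank_concave {p q : ℕ} (M : Matrix (Fin p) (Fin q) F[X]) (k : ℕ) :
    sylvRank M (k + 2) + sylvRank M k ≤ 2 * sylvRank M (k + 1) := by
  let N (l : ℕ) : Submodule F (Fin q → F[X]) :=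
    (vecDegreeLT F fun _ => l) ⊓ LinearMap.ker (polyMulVec M)
  let σ : (Fin q → F[X]) →ₗ[F] (Fin q → F[X]) :=
    ((LinearMap.lsmul F[X] (Fin q → F[X])) X).restrictScalars F
  have hσ (v) : σ v = (X : F[X]) • v := rfl
  have hσi : Function.Injective σ := by
    intro v w h
    rw [hσ, hσ] at h
    exact smul_right_injective _ X_ne_zero h
  have hfin (l : ℕ) : Module.Finite F (N l) :=
    Submodule.finiteDimensional_inf_left _ _
  have hmap (l : ℕ) : Module.finrank F ((N l).map σ) = Module.finrank F (N l) :=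
    (Submodule.equivMapOfInjective _ hσi _).finrank_eq.symm
  have hsup : N (k + 1) ⊔ (N (k + 1)).map σ ≤ N (k + 2) := by
    refine sup_le (fun v hv => ⟨?_, hv.2⟩) ?_
    · have h := mem_vecDegreeLT.1 hv.1
      exact mem_vecDegreeLT.2 fun i t ht => h i t (by omega)
    · rintro _ ⟨v, hv, rfl⟩
      have h := mem_vecDegreeLT.1 hv.1
      refine ⟨mem_vecDegreeLT.2 fun i t ht => ?_, ?_⟩
      · obtain ⟨t, rfl⟩ : ∃ s, t = s + 1 := ⟨t - 1, by omega⟩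
        simpa [hσ] using h i t (by omega)
      · have h2 : M *ᵥ v = 0 := hv.2
        simp [hσ, mulVec_smul, h2]
  have hinf : N (k + 1) ⊓ (N (k + 1)).map σ ≤ (N k).map σ := by
    rintro _ ⟨hw, v, hv, rfl⟩
    have h := mem_vecDegreeLT.1 hw.1
    refine ⟨v, ⟨mem_vecDegreeLT.2 fun i t ht => ?_, hv.2⟩, rfl⟩
    simpa [hσ] using h i (t + 1) (by omega)
  have h1 := Submodule.finrank_mono hsup
  have h2 := Submodule.finrank_mono hinf
  have h3 := Submodule.finrank_sup_add_finrank_inf_eq (N (k + 1)) ((N (k + 1)).map σ)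
  rw [hmap] at h2 h3
  have e0 := sylvRank_add_finrank_ker M k
  have e1 := sylvRank_add_finrank_ker M (k + 1)
  have e2 := sylvRank_add_finrank_ker M (k + 2)
  simp only [mul_add] at e1 e2
  simp only [N] at h1 h2 h3
  omega

lemma ratRow_sum {p q : ℕ} (M : Matrix (Fin p) (Fin q) F[X]) (c : Fin p → F[X]) :
    ∑ i, algebraMap F[X] (RatFunc F) (c i) • ratRow M i =
      fun j => algebraMap F[X] (RatFunc F) ((c ᵥ* M) j) := by
  ext j
  simp [ratRow, vecMul, dotProduct, Algebra.smul_def]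

lemma linearIndependent_ratRow_iff {p q : ℕ} {M : Matrix (Fin p) (Fin q) F[X]} :
    LinearIndependent (RatFunc F) (ratRow M) ↔ ∀ c : Fin p → F[X], c ᵥ* M = 0 → c = 0 := by
  rw [← LinearIndependent.iff_fractionRing F[X] (RatFunc F), Fintype.linearIndependent_iff]
  have key (c : Fin p → F[X]) : ∑ i, c i • ratRow M i = 0 ↔ c ᵥ* M = 0 := by
    simp_rw [← algebraMap_smul (RatFunc F) (c _), ratRow_sum, funext_iff]
    simp
  simp_rw [key, funext_iff, Pi.zero_apply]

lemma ker_polyMulVec_eq_of_rowSpan_eq {p p' q : ℕ} {M : Matrix (Fin p) (Fin q) F[X]}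
    {M' : Matrix (Fin p') (Fin q) F[X]} (h : rowSpan M = rowSpan M') :
    LinearMap.ker (polyMulVec M) = LinearMap.ker (polyMulVec M') := by
  have key {l : ℕ} (A : Matrix (Fin l) (Fin q) F[X]) (v : Fin q → F[X]) :
      v ∈ LinearMap.ker (polyMulVec A) ↔
        ∀ x ∈ rowSpan A, x ⬝ᵥ (fun j => algebraMap F[X] (RatFunc F) (v j)) = 0 := by
    have hrow (i) : ratRow A i ⬝ᵥ (fun j => algebraMap F[X] (RatFunc F) (v j)) =
        algebraMap F[X] (RatFunc F) ((A *ᵥ v) i) := by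
      simp [ratRow, mulVec, dotProduct]
    rw [LinearMap.mem_ker, polyMulVec_apply]
    constructor
    · intro hv x hx
      induction hx using Submodule.span_induction with
      | mem x hx => obtain ⟨i, rfl⟩ := hx; rw [hrow, hv]; simp
      | zero => simp
      | add x y _ _ hx hy => rw [add_dotProduct, hx, hy, add_zero]
      | smul a x _ hx => rw [smul_dotProduct, hx, smul_zero]
    · intro hx
      ext1 i
      have := hx _ (Submodule.subset_span ⟨i, rfl⟩)
      rw [hrow] at this
      simpa using this
  ext v
  rw [key, key, h]

lemma sylvRank_eq_of_rowSpan_eq {p p' q : ℕ} {M : Matrix (Fin p) (Fin q) F[X]}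
    {M' : Matrix (Fin p') (Fin q) F[X]} (h : rowSpan M = rowSpan M') (k : ℕ) :
    sylvRank M k = sylvRank M' k := by
  have h1 := sylvRank_add_finrank_ker M k
  have h2 := sylvRank_add_finrank_ker M' k
  rw [ker_polyMulVec_eq_of_rowSpan_eq h] at h1
  omega

/-- In a minimal basis no row can be exchanged for a row of lower degree. -/
lemma IsMinimalBasis.not_exists_lower_row {p q : ℕ} {M : Matrix (Fin p) (Fin q) F[X]}
    (h : IsMinimalBasis M) {c : Fin p → F[X]} {r : F[X]} (hr : r ≠ 0) {w : Fin q → F[X]}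
    (hw : c ᵥ* M = r • w) {i : Fin p} (hi : c i ≠ 0)
    (hdeg : ∀ j, degree ((c ᵥ* M) j) < degree r + (rowDeg M i : WithBot ℕ)) : False := by
  obtain ⟨hli, -, hmin⟩ := h
  have hw0 : w ≠ 0 := by
    rintro rfl
    rw [smul_zero] at hw
    exact hi (congrFun (linearIndependent_ratRow_iff.1 hli c hw) i)
  have hlt (j) (hj : w j ≠ 0) : (w j).natDegree < rowDeg M i := by
    have := hdeg j
    rw [hw, Pi.smul_apply, smul_eq_mul, degree_mul, degree_eq_natDegree hr,
      degree_eq_natDegree hj] at this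
    norm_cast at this
    omega
  obtain ⟨j₀, hj₀⟩ := Function.ne_iff.1 hw0
  have hpos : 0 < rowDeg M i := (Nat.zero_le _).trans_lt (hlt j₀ hj₀)
  set M' := M.updateRow i w with hM'
  have hrow (l) (hl : l ≠ i) : ratRow M' l = ratRow M l := by
    ext j; simp [ratRow, hM', updateRow_ne hl]
  have hrowi : ratRow M' i = fun j => algebraMap F[X] (RatFunc F) (w j) := by
    ext j; simp [ratRow, hM']
  have hsum : ∑ l, algebraMap F[X] (RatFunc F) (c l) • ratRow M l =
      algebraMap F[X] (RatFunc F) r • ratRow M' i := by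
    rw [ratRow_sum, hw, hrowi]
    ext j
    simp
  have hspan : rowSpan M' = rowSpan M := by
    apply le_antisymm
    · refine Submodule.span_le.2 ?_
      rintro _ ⟨l, rfl⟩
      by_cases hl : l = i
      · subst hl
        have hr' : algebraMap F[X] (RatFunc F) r ≠ 0 := by simpa using hr
        refine (Submodule.smul_mem_iff _ hr').1 ?_
        rw [← hsum]
        exact Submodule.sum_mem _ fun l _ =>
          Submodule.smul_mem _ _ (Submodule.subset_span ⟨l, rfl⟩)
      · rw [hrow l hl]
        exact Submodule.subset_span ⟨l, rfl⟩
    · have hne (l) (hl : l ≠ i) : ratRow M l ∈ rowSpan M' := by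
        rw [← hrow l hl]
        exact Submodule.subset_span ⟨l, rfl⟩
      refine Submodule.span_le.2 ?_
      rintro _ ⟨l, rfl⟩
      by_cases hl : l = i
      · subst hl
        have hc' : algebraMap F[X] (RatFunc F) (c l) ≠ 0 := by simpa using hi
        refine (Submodule.smul_mem_iff _ hc').1 ?_
        rw [← Finset.add_sum_erase _ _ (Finset.mem_univ l), ← eq_sub_iff_add_eq] at hsum
        rw [hsum]
        refine Submodule.sub_mem _ (Submodule.smul_mem _ _ (Submodule.subset_span ⟨l, rfl⟩)) ?_
        exact Submodule.sum_mem _ fun l' hl' =>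
          Submodule.smul_mem _ _ (hne l' (Finset.ne_of_mem_erase hl'))
      · exact hne l hl
  have hli' : LinearIndependent (RatFunc F) (ratRow M') := by
    rw [linearIndependent_iff_card_eq_finrank_span] at hli ⊢
    rw [hli]
    exact (congrArg (fun S : Submodule _ _ => Module.finrank (RatFunc F) S) hspan).symm
  refine (hmin M' hli' hspan).not_gt (Finset.sum_lt_sum (fun l _ => ?_) ⟨i, Finset.mem_univ i, ?_⟩)
  · by_cases hl : l = i
    · subst hl
      refine Finset.sup_le fun j _ => ?_
      simp only [hM', updateRow_self]
      by_cases hj : w j = 0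
      · simp [hj]
      · exact (hlt j hj).le
    · simp [rowDeg, hM', updateRow_ne hl]
  · refine (Finset.sup_lt_iff hpos).2 fun j _ => ?_
    simp only [hM', updateRow_self]
    by_cases hj : w j = 0
    · simpa [hj] using hpos
    · exact hlt j hj

/-- The highest-row-degree coefficient matrix of a minimal basis has independent rows. -/
lemma IsMinimalBasis.linearIndependent_highRowMat {p q : ℕ} {M : Matrix (Fin p) (Fin q) F[X]}
    (h : IsMinimalBasis M) : LinearIndependent F (highRowMat M).row := by
  by_contra hli
  obtain ⟨a, ha, i₀, hi₀⟩ := Fintype.not_linearIndependent_iff.1 hli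
  classical
  obtain ⟨i, hi, hmax⟩ := Finset.exists_max_image (Finset.univ.filter fun l => a l ≠ 0)
    (rowDeg M) ⟨i₀, by simpa using hi₀⟩
  simp only [Finset.mem_filter, Finset.mem_univ, true_and] at hi hmax
  have hcoeff (j : Fin q) : ∑ l, a l * (M l j).coeff (rowDeg M l) = 0 := by
    simpa [highRowMat, Matrix.row] using congrFun ha j
  refine h.not_exists_lower_row one_ne_zero (c := fun l => C (a l) * X ^ (rowDeg M i - rowDeg M l))
    (one_smul _ _).symm (i := i) (by simpa using hi) fun j => ?_
  rw [degree_one, zero_add, degree_lt_iff_coeff_zero]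
  intro t ht
  simp only [vecMul, dotProduct, finsetSum_coeff, mul_assoc, coeff_C_mul, coeff_X_pow_mul']
  rcases ht.eq_or_lt with rfl | ht
  · rw [← hcoeff j]
    refine Finset.sum_congr rfl fun l _ => ?_
    by_cases hl : a l = 0
    · simp [hl]
    · rw [if_pos (Nat.sub_le _ _), Nat.sub_sub_self (hmax l hl)]
  · refine Finset.sum_eq_zero fun l _ => ?_
    by_cases hl : a l = 0
    · simp [hl]
    · have h1 := hmax l hl
      have h2 := natDegree_le_rowDeg M l j
      rw [coeff_eq_zero_of_natDegree_lt (by omega)]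
      simp

/-- A row-reduced polynomial matrix has independent rows. -/
lemma linearIndependent_ratRow_of_highRowMat {p q : ℕ} {M : Matrix (Fin p) (Fin q) F[X]}
    (h : LinearIndependent F (highRowMat M).row) :
    LinearIndependent (RatFunc F) (ratRow M) := by
  refine linearIndependent_ratRow_iff.2 fun c hc => ?_
  by_contra hc0
  obtain ⟨i₀, hi₀⟩ := Function.ne_iff.1 hc0
  classical
  obtain ⟨i, hi, hmax⟩ := Finset.exists_max_image (Finset.univ.filter fun l => c l ≠ 0)
    (fun l => (c l).natDegree + rowDeg M l) ⟨i₀, by simpa using hi₀⟩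
  simp only [Finset.mem_filter, Finset.mem_univ, true_and] at hi hmax
  set N := (c i).natDegree + rowDeg M i with hN
  have ha := Fintype.linearIndependent_iff.1 h (fun l => (c l).coeff (N - rowDeg M l)) ?_ i
  · rw [hN, Nat.add_sub_cancel] at ha
    exact hi (leadingCoeff_eq_zero.1 ha)
  · ext j
    have := congrArg (fun v => (v j).coeff N) hc
    simp only [vecMul, dotProduct, finsetSum_coeff, Pi.zero_apply, coeff_zero] at this
    rw [Finset.sum_apply, Pi.zero_apply, ← this]
    refine Finset.sum_congr rfl fun l _ => ?_
    by_cases hl : c l = 0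
    · simp [hl]
    · have h1 := hmax l hl
      have h2 := coeff_mul_add_eq_of_natDegree_le (f := c l) (g := M l j) (df := N - rowDeg M l)
        (dg := rowDeg M l) (by omega) (natDegree_le_rowDeg M l j)
      rw [Nat.sub_add_cancel (by omega)] at h2
      rw [h2]
      rfl

/-- A minimal basis has full row rank modulo every irreducible polynomial, so it is right
invertible. -/
lemma IsMinimalBasis.exists_right_inverse {p q : ℕ} {M : Matrix (Fin p) (Fin q) F[X]}
    (h : IsMinimalBasis M) : ∃ W : Matrix (Fin q) (Fin p) F[X], M * W = 1 := by
  rw [← Matrix.mulVec_surjective_iff_exists_right_inverse]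
  change Function.Surjective M.mulVecLin
  rw [← LinearMap.range_eq_top]
  by_contra hne
  obtain ⟨S, hS, hle⟩ := (eq_top_or_exists_le_coatom (LinearMap.range M.mulVecLin)).resolve_left hne
  obtain ⟨I, hI, ⟨e⟩⟩ := isSimpleModule_iff_quot_maximal.1 (isSimpleModule_iff_isCoatom.2 hS)
  let φ : (Fin p → F[X]) →ₗ[F[X]] F[X] ⧸ I := e.toLinearMap ∘ₗ S.mkQ
  have hφ (x) : φ x = 0 ↔ x ∈ S := by simp [φ]
  obtain ⟨r, hr⟩ := (IsPrincipalIdealRing.principal I).principal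
  have hmem (f : F[X]) : Ideal.Quotient.mk I f = 0 ↔ r ∣ f := by
    rw [Ideal.Quotient.eq_zero_iff_mem, hr, ← Ideal.mem_span_singleton]
  have hr0 : r ≠ 0 := by
    rintro rfl
    refine Ring.ne_bot_of_isMaximal_of_not_isField hI (Polynomial.not_isField F) ?_
    rw [hr]; simp
  have hrep (i) : ∃ f : F[X], Ideal.Quotient.mk I f = φ (Pi.single i 1) ∧ degree f < degree r := by
    obtain ⟨f, hf⟩ := Ideal.Quotient.mk_surjective (φ (Pi.single i 1))
    refine ⟨f % r, ?_, degree_mod_lt f hr0⟩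
    rw [← hf, Ideal.Quotient.eq, hr]
    refine Ideal.mem_span_singleton.2 ⟨-(f / r), ?_⟩
    linear_combination EuclideanDomain.mod_add_div f r
  choose c hc hcdeg using hrep
  have hφc (x : Fin p → F[X]) : φ x = Ideal.Quotient.mk I (c ⬝ᵥ x) := by
    conv_lhs => rw [pi_eq_sum_univ' x]
    simp only [map_sum, map_smul, dotProduct, map_mul, hc, mul_comm (φ _)]
    rfl
  have hdvd (j) : r ∣ (c ᵥ* M) j := by
    rw [← hmem]
    have : (c ᵥ* M) j = c ⬝ᵥ (M *ᵥ Pi.single j 1) := by simp [vecMul, Matrix.col]; rfl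
    rw [this, ← hφc, hφ]
    exact hle ⟨_, rfl⟩
  choose w hw using hdvd
  have hc0 : ∃ i, c i ≠ 0 := by
    by_contra! hc0
    refine hS.1 (eq_top_iff.2 fun x _ => (hφ x).1 ?_)
    rw [hφc, show c = 0 from funext hc0]
    simp
  obtain ⟨i₀, hi₀⟩ := hc0
  classical
  obtain ⟨i, hi, hmax⟩ := Finset.exists_max_image (Finset.univ.filter fun l => c l ≠ 0)
    (rowDeg M) ⟨i₀, by simpa using hi₀⟩
  simp only [Finset.mem_filter, Finset.mem_univ, true_and] at hi hmax
  refine h.not_exists_lower_row hr0 (funext hw) hi fun j => ?_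
  have hrd : degree r + (rowDeg M i : WithBot ℕ) = ((r.natDegree + rowDeg M i : ℕ) : WithBot ℕ) := by
    rw [degree_eq_natDegree hr0]; norm_cast
  rw [hrd, vecMul, dotProduct]
  refine (degree_sum_le _ _).trans_lt ((Finset.sup_lt_iff (WithBot.bot_lt_coe _)).2 fun l _ => ?_)
  by_cases hl : c l * M l j = 0
  · rw [hl, degree_zero]; exact WithBot.bot_lt_coe _
  · have hcl := left_ne_zero_of_mul hl
    have h1 := hmax l hcl
    have h2 := natDegree_le_rowDeg M l j
    have h3 := natDegree_lt_natDegree hcl (hcdeg l)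
    rw [degree_eq_natDegree hl, natDegree_mul hcl (right_ne_zero_of_mul hl)]
    norm_cast
    omega

lemma vecDegreeLT_le_map_sup {p q : ℕ} {M : Matrix (Fin p) (Fin q) F[X]}
    (h : LinearIndependent F (highRowMat M).row) (k : ℕ) :
    vecDegreeLT F (fun i => k + rowDeg M i) ≤
      (vecDegreeLT F fun _ => k).map (polyMulVec M) ⊔ vecDegreeLT F (rowDeg M) := by
  have hsurj : Function.Surjective (highRowMat M).mulVecLin := by
    rw [← LinearMap.range_eq_top]
    refine Submodule.eq_top_of_finrank_eq ?_
    rw [Module.finrank_fin_fun]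
    exact h.rank_matrix.trans (Fintype.card_fin p)
  induction k with
  | zero => simp
  | succ k ih =>
    intro u hu
    have hu' := mem_vecDegreeLT.1 hu
    obtain ⟨a, ha⟩ := hsurj fun i => (u i).coeff (k + rowDeg M i)
    let v : Fin q → F[X] := fun j => monomial k (a j)
    have hv : v ∈ vecDegreeLT F fun _ => k + 1 :=
      mem_vecDegreeLT.2 fun j t ht => by
        simp only [v, coeff_monomial]; exact if_neg (by omega)
    have hcoeff (i t) : ((M *ᵥ v) i).coeff (t + k) = ∑ j, (M i j).coeff t * a j := by
      simp [v, mulVec, dotProduct, coeff_mul_monomial]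
    have hsub : u - polyMulVec M v ∈ vecDegreeLT F fun i => k + rowDeg M i := by
      refine mem_vecDegreeLT.2 fun i t ht => ?_
      obtain ⟨t, rfl⟩ : ∃ s, t = s + k := ⟨t - k, by omega⟩
      rw [Pi.sub_apply, coeff_sub, polyMulVec_apply, hcoeff]
      rcases (show rowDeg M i ≤ t by omega).eq_or_lt with rfl | hlt
      · have := congrFun ha i
        rw [add_comm, ← this]
        exact sub_self _
      · rw [hu' i _ (by omega), zero_sub, neg_eq_zero]
        refine Finset.sum_eq_zero fun j _ => ?_
        rw [coeff_eq_zero_of_natDegree_lt ((natDegree_le_rowDeg M i j).trans_lt hlt), zero_mul]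
    have hmono : (vecDegreeLT F fun _ => k).map (polyMulVec M) ≤
        (vecDegreeLT F fun _ => k + 1).map (polyMulVec M) :=
      Submodule.map_mono fun x hx => mem_vecDegreeLT.2 fun j t ht =>
        mem_vecDegreeLT.1 hx j t (by omega)
    rw [← sub_add_cancel u (polyMulVec M v)]
    exact Submodule.add_mem _ (sup_le_sup_right hmono _ (ih hsub))
      (Submodule.mem_sup_left ⟨v, hv, rfl⟩)

/-- The ranks of the Sylvester matrices of a minimal basis eventually attain their upper bound. -/
lemma IsMinimalBasis.exists_sylvRank_eq {p q : ℕ} {M : Matrix (Fin p) (Fin q) F[X]}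
    (h : IsMinimalBasis M) :
    ∃ K, ∀ k, K ≤ k → sylvRank M k = p * k + ∑ i, rowDeg M i := by
  obtain ⟨W, hW⟩ := h.exists_right_inverse
  refine ⟨∑ i, rowDeg M i + ∑ j, rowDeg W j, fun k hk => (sylvRank_le M k).antisymm ?_⟩
  have hlow : vecDegreeLT F (rowDeg M) ≤ (vecDegreeLT F fun _ => k).map (polyMulVec M) := by
    intro u hu
    have hu' : u ∈ vecDegreeLT F fun _ => ∑ i, rowDeg M i :=
      mem_vecDegreeLT.2 fun i t ht => mem_vecDegreeLT.1 hu i t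
        ((Finset.single_le_sum (fun _ _ => Nat.zero_le _) (Finset.mem_univ i)).trans ht)
    have hWu := mem_vecDegreeLT.1 (map_vecDegreeLT_le W _ ⟨u, hu', rfl⟩)
    refine ⟨W *ᵥ u, mem_vecDegreeLT.2 fun j t ht => hWu j t ?_, by simp [hW]⟩
    have := Finset.single_le_sum (f := rowDeg W) (fun _ _ => Nat.zero_le _) (Finset.mem_univ j)
    omega
  have := Submodule.finrank_mono ((vecDegreeLT_le_map_sup h.linearIndependent_highRowMat k).trans
    (sup_le le_rfl hlow))
  rw [finrank_vecDegreeLT] at this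
  simpa [Finset.sum_add_distrib, sylvRank] using this

/-- A finite number of rank conditions characterizing minimal bases: `M(λ)` is a
minimal basis if and only if its highest-row-degree coefficient matrix has full row
rank `m` and, `d'` being the smallest index `k` with `r_{k+1} = r_k + m`,
`r_{d'} - m·d' = d_1 + ⋯ + d_m`. -/
theorem isMinimalBasis_iff_rank_conditions {F : Type*} [Field F] {m n d : ℕ}
    (hm : 0 < m) (hn : 0 < n) (hd : 0 < d)
    (M : Matrix (Fin m) (Fin (m + n)) F[X]) (hdeg : ∀ i j, (M i j).natDegree ≤ d) :
    IsMinimalBasis M ↔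
      ((highRowMat M).rank = m ∧
        ∃ h : ∃ k : ℕ, (sylv d (k + 1) M).rank = (sylv d k M).rank + m,
          (sylv d (Nat.find h) M).rank = m * Nat.find h + ∑ i, rowDeg M i) := by
  simp_rw [rank_sylv _ M hdeg]
  constructor
  · intro h
    refine ⟨by simpa using h.linearIndependent_highRowMat.rank_matrix, ?_⟩
    obtain ⟨K, hK⟩ := h.exists_sylvRank_eq
    refine ⟨⟨K, by rw [hK K le_rfl, hK (K + 1) (by omega)]; ring⟩, ?_⟩
    generalize_proofs hex
    have hspec := Nat.find_spec hex
    generalize Nat.find hex = k at hspec ⊢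
    have hstep (j : ℕ) : sylvRank M (k + j + 1) ≤ sylvRank M (k + j) + m := by
      induction j with
      | zero => exact hspec.le
      | succ j ih =>
        have := sylvRank_concave M (k + j)
        rw [← add_assoc]
        change sylvRank M (k + j + 2) ≤ _
        omega
    have hle (j : ℕ) : sylvRank M (k + j) ≤ sylvRank M k + m * j := by
      induction j with
      | zero => simp
      | succ j ih =>
        have := hstep j
        rw [← add_assoc, mul_add]
        omega
    have h1 := hle K
    rw [hK (k + K) (by omega), mul_add] at h1
    have h2 := sylvRank_le M k
    omega
  · rintro ⟨hrank, hex, heq⟩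
    have hli : LinearIndependent F (highRowMat M).row := by
      rw [linearIndependent_iff_card_eq_finrank_span, Fintype.card_fin, Set.finrank,
        ← Matrix.rank_eq_finrank_span_row, hrank]
    refine ⟨linearIndependent_ratRow_of_highRowMat hli, rfl, fun M' _ hspan => ?_⟩
    have := sylvRank_le M' (Nat.find hex)
    rw [sylvRank_eq_of_rowSpan_eq hspan, heq] at this
    omega

end
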